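/- Symmetry property of the polynomials P: for nonnegative integers m₁,m₂,m₃,n₁,n₂,n₃ with m₁+m₂ = n₁+n₂ and m₂+m₃ = n₂+n₃, one has P_{m₂}(q^{2n₁},q^{2n₂},q^{2n₃}) (q²;q²)_{m₁}(q²;q²)_{m₃} = (q²;q²)_{n₁}(q²;q²)_{n₃} P_{n₂}(q^{2m₁},q^{2m₂},q^{2m₃}). -/

import Mathlib

noncomputable def P {K : Type*} [Field K] (q : K) : ℕ → K → K → K → K
  | 0, _, _, _ => 1
  | m + 1, x, y, z =>
      (1 - x) * (1 - z) * P q m (x / q ^ 2) y (z / q ^ 2)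
        - (x * z / q ^ (2 * m)) * (1 - y) * P q m x (y / q ^ 2) z

noncomputable def qPoch {K : Type*} [Field K] (q : K) (m : ℕ) : K :=
  ∏ k ∈ Finset.range m, (1 - q ^ (2 * (k + 1)))

/-- The falling `p`-Pochhammer product `(1 - x)(1 - x / p) ⋯ (1 - x / p ^ (n - 1))`. -/
noncomputable def fallingPoch {K : Type*} [Field K] (p x : K) (n : ℕ) : K :=
  ∏ i ∈ Finset.range n, (1 - x / p ^ i)

/-- The coefficient of `(-(x z)) ^ k` times falling products in the expansion of `P q m x y z`. -/
noncomputable def coeffP {K : Type*} [Field K] (q : K) (m k : ℕ) : K :=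
  (∏ i ∈ Finset.range k, (q ^ 2) ^ (3 * i + 2)) / (q ^ 2) ^ (2 * m * k)
    * fallingPoch (q ^ 2) ((q ^ 2) ^ m) k / qPoch q k

section

variable {K : Type*} [Field K]

lemma fallingPoch_zero (p x : K) : fallingPoch p x 0 = 1 := by simp [fallingPoch]

lemma fallingPoch_succ (p x : K) (n : ℕ) :
    fallingPoch p x (n + 1) = fallingPoch p x n * (1 - x / p ^ n) :=
  Finset.prod_range_succ _ _

lemma fallingPoch_succ' (p x : K) (n : ℕ) :
    fallingPoch p x (n + 1) = (1 - x) * fallingPoch p (x / p) n := by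
  simp [fallingPoch, Finset.prod_range_succ', pow_succ', div_div, mul_comm]

lemma fallingPoch_pow_eq_zero {p : K} (hp : p ≠ 0) {m k : ℕ} (h : m < k) :
    fallingPoch p (p ^ m) k = 0 :=
  Finset.prod_eq_zero (Finset.mem_range.2 h) (by simp [hp])

lemma qPoch_succ (q : K) (m : ℕ) :
    qPoch q (m + 1) = qPoch q m * (1 - (q ^ 2) ^ (m + 1)) := by
  rw [← pow_mul]; exact Finset.prod_range_succ _ _

lemma qPoch_ne_zero {q : K} (hroot : ∀ k : ℕ, 0 < k → q ^ k ≠ 1) (m : ℕ) : qPoch q m ≠ 0 :=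
  Finset.prod_ne_zero_iff.2 fun _ _ => sub_ne_zero.2 (hroot _ (by omega)).symm

lemma fallingPoch_mul_qPoch {q : K} (hq : q ≠ 0) (n a : ℕ) :
    fallingPoch (q ^ 2) ((q ^ 2) ^ (n + a)) a * qPoch q n = qPoch q (n + a) := by
  induction a with
  | zero => simp [fallingPoch_zero]
  | succ a ih =>
    rw [← add_assoc, fallingPoch_succ', qPoch_succ, ← ih, pow_succ _ (n + a),
      mul_div_cancel_right₀ _ (pow_ne_zero 2 hq)]
    ring

lemma fallingPoch_mul_qPoch_comm {q : K} (hq : q ≠ 0) {n m a b : ℕ} (h : n + b = m + a) :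
    fallingPoch (q ^ 2) ((q ^ 2) ^ n) a * qPoch q m
      = qPoch q n * fallingPoch (q ^ 2) ((q ^ 2) ^ m) b := by
  rcases le_or_gt a n with han | han
  · obtain ⟨d, rfl⟩ := Nat.exists_eq_add_of_le' han
    obtain rfl : m = d + b := by omega
    rw [← fallingPoch_mul_qPoch hq d a, ← fallingPoch_mul_qPoch hq d b]
    ring
  · rw [fallingPoch_pow_eq_zero (pow_ne_zero 2 hq) han,
      fallingPoch_pow_eq_zero (pow_ne_zero 2 hq) (by omega : m < b)]
    ring

lemma coeffP_zero_right (q : K) (m : ℕ) : coeffP q m 0 = 1 := by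
  simp [coeffP, fallingPoch_zero, qPoch]

lemma coeffP_eq_zero {q : K} (hq : q ≠ 0) {m k : ℕ} (h : m < k) : coeffP q m k = 0 := by
  simp [coeffP, fallingPoch_pow_eq_zero (pow_ne_zero 2 hq) h]

lemma coeffP_succ_succ {q : K} (hq : q ≠ 0) (hroot : ∀ k : ℕ, 0 < k → q ^ k ≠ 1) (m k : ℕ) :
    coeffP q (m + 1) (k + 1)
      = coeffP q m (k + 1) / (q ^ 2) ^ (2 * (k + 1)) + coeffP q m k / (q ^ 2) ^ m := by
  have hp : q ^ 2 ≠ 0 := pow_ne_zero 2 hq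
  have hk : 1 - (q ^ 2) ^ (k + 1) ≠ 0 := by
    rw [← pow_mul]; exact sub_ne_zero.2 (hroot _ (by omega)).symm
  have hP := qPoch_ne_zero hroot k
  simp only [coeffP]
  rw [fallingPoch_succ', fallingPoch_succ, qPoch_succ, Finset.prod_range_succ,
    pow_succ (q ^ 2) m, mul_div_cancel_right₀ _ hp]
  generalize fallingPoch (q ^ 2) ((q ^ 2) ^ m) k = F
  generalize qPoch q k = Q at *
  generalize ∏ i ∈ Finset.range k, (q ^ 2) ^ (3 * i + 2) = E
  generalize q ^ 2 = p at *
  have e₁ : p ^ (2 * (m + 1) * (k + 1)) = p ^ (2 * m * k) * (p ^ m) ^ 2 * (p ^ k) ^ 2 * p ^ 2 := by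
    ring
  have e₂ : p ^ (2 * m * (k + 1)) = p ^ (2 * m * k) * (p ^ m) ^ 2 := by ring
  have e₃ : p ^ (2 * (k + 1)) = (p ^ k) ^ 2 * p ^ 2 := by ring
  have e₄ : p ^ (3 * k + 2) = (p ^ k) ^ 3 * p ^ 2 := by ring
  rw [pow_succ] at hk
  rw [e₁, e₂, e₃, e₄, pow_succ p k]
  have h₁ : p ^ m ≠ 0 := pow_ne_zero _ hp
  have h₂ : p ^ k ≠ 0 := pow_ne_zero _ hp
  have h₃ : p ^ (2 * m * k) ≠ 0 := pow_ne_zero _ hp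
  generalize p ^ (2 * m * k) = c at *
  generalize p ^ m = a at *
  generalize p ^ k = b at *
  field_simp
  ring

lemma P_eq_sum {q : K} (hq : q ≠ 0) (hroot : ∀ k : ℕ, 0 < k → q ^ k ≠ 1) (m : ℕ) (x y z : K) :
    P q m x y z = ∑ k ∈ Finset.range (m + 1), coeffP q m k * ((-(x * z)) ^ k
      * fallingPoch (q ^ 2) x (m - k) * fallingPoch (q ^ 2) z (m - k)
      * fallingPoch (q ^ 2) y k) := by
  induction m generalizing x y z with
  | zero => simp [P, coeffP_zero_right, fallingPoch_zero]
  | succ m ih =>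
    have hp : q ^ 2 ≠ 0 := pow_ne_zero 2 hq
    set G : ℕ → K := fun k => (-(x * z)) ^ k
      * fallingPoch (q ^ 2) x (m + 1 - k) * fallingPoch (q ^ 2) z (m + 1 - k)
      * fallingPoch (q ^ 2) y k with hG
    have hX : (1 - x) * (1 - z) * P q m (x / q ^ 2) y (z / q ^ 2)
        = ∑ k ∈ Finset.range (m + 1), coeffP q m k / (q ^ 2) ^ (2 * k) * G k := by
      rw [ih, Finset.mul_sum]
      refine Finset.sum_congr rfl fun k hk => ?_
      have hkm : m + 1 - k = m - k + 1 := by have := Finset.mem_range.1 hk; omega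
      have hpow : (-(x / q ^ 2 * (z / q ^ 2))) ^ k = (-(x * z)) ^ k / (q ^ 2) ^ (2 * k) := by
        rw [pow_mul, ← div_pow]
        congr 1
        field_simp
      simp only [hG, hkm, fallingPoch_succ', hpow]
      ring
    have hY : (x * z / q ^ (2 * m)) * (1 - y) * P q m x (y / q ^ 2) z
        = -∑ k ∈ Finset.range (m + 1), coeffP q m k / (q ^ 2) ^ m * G (k + 1) := by
      rw [ih, Finset.mul_sum, ← Finset.sum_neg_distrib]
      refine Finset.sum_congr rfl fun k _ => ?_
      simp only [hG, Nat.add_sub_add_right, fallingPoch_succ' _ y, pow_mul]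
      ring
    have hX' : ∑ k ∈ Finset.range (m + 1), coeffP q m k / (q ^ 2) ^ (2 * k) * G k
        = ∑ k ∈ Finset.range (m + 1),
            coeffP q m (k + 1) / (q ^ 2) ^ (2 * (k + 1)) * G (k + 1) + G 0 := by
      have h := Finset.sum_range_succ (fun k => coeffP q m k / (q ^ 2) ^ (2 * k) * G k) (m + 1)
      rw [Finset.sum_range_succ', coeffP_eq_zero hq m.lt_succ_self, coeffP_zero_right] at h
      simpa using h.symm
    rw [P, hX, hY, hX', Finset.sum_range_succ' _ (m + 1), coeffP_zero_right]
    simp only [coeffP_succ_succ hq hroot, add_mul, Finset.sum_add_distrib]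
    ring

/-- The expansion of `P q m x y z` extended by vanishing terms. -/
lemma P_eq_sum_of_lt {q : K} (hq : q ≠ 0) (hroot : ∀ k : ℕ, 0 < k → q ^ k ≠ 1) {m N : ℕ}
    (h : m < N) (x y z : K) :
    P q m x y z = ∑ k ∈ Finset.range N, coeffP q m k * ((-(x * z)) ^ k
      * fallingPoch (q ^ 2) x (m - k) * fallingPoch (q ^ 2) z (m - k)
      * fallingPoch (q ^ 2) y k) := by
  rw [P_eq_sum hq hroot]
  refine Finset.sum_subset (Finset.range_subset_range.2 h) fun k _ hk => ?_
  rw [coeffP_eq_zero hq (by simpa using hk), zero_mul]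

end

/-- Symmetry property:
`P_{m₂}(q^{2n₁},q^{2n₂},q^{2n₃}) (q²;q²)_{m₁}(q²;q²)_{m₃}
  = (q²;q²)_{n₁}(q²;q²)_{n₃} P_{n₂}(q^{2m₁},q^{2m₂},q^{2m₃})`
whenever `m₁+m₂ = n₁+n₂` and `m₂+m₃ = n₂+n₃`. -/
theorem P_symmetry {K : Type*} [Field K] (q : K) (hq : q ≠ 0)
    (hroot : ∀ k : ℕ, 0 < k → q ^ k ≠ 1)
    (m₁ m₂ m₃ n₁ n₂ n₃ : ℕ) (h₁ : m₁ + m₂ = n₁ + n₂) (h₂ : m₂ + m₃ = n₂ + n₃) :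
    P q m₂ (q ^ (2 * n₁)) (q ^ (2 * n₂)) (q ^ (2 * n₃)) * (qPoch q m₁ * qPoch q m₃)
      = qPoch q n₁ * qPoch q n₃ *
          P q n₂ (q ^ (2 * m₁)) (q ^ (2 * m₂)) (q ^ (2 * m₃)) := by
  have hp : q ^ 2 ≠ 0 := pow_ne_zero 2 hq
  simp only [pow_mul]
  rw [P_eq_sum_of_lt hq hroot (by omega : m₂ < m₂ + n₂ + 1),
    P_eq_sum_of_lt hq hroot (by omega : n₂ < m₂ + n₂ + 1), Finset.sum_mul, Finset.mul_sum]
  refine Finset.sum_congr rfl fun k _ => ?_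
  rcases lt_or_ge m₂ k with hm | hm
  · simp [coeffP_eq_zero hq hm, fallingPoch_pow_eq_zero hp hm]
  rcases lt_or_ge n₂ k with hn | hn
  · simp [coeffP_eq_zero hq hn, fallingPoch_pow_eq_zero hp hn]
  have hx := fallingPoch_mul_qPoch_comm hq (n := n₁) (m := m₁) (a := m₂ - k) (b := n₂ - k)
    (by omega)
  have hz := fallingPoch_mul_qPoch_comm hq (n := n₃) (m := m₃) (a := m₂ - k) (b := n₂ - k)
    (by omega)
  have hpow : (-((q ^ 2) ^ n₁ * (q ^ 2) ^ n₃)) ^ k / (q ^ 2) ^ (2 * m₂ * k)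
      = (-((q ^ 2) ^ m₁ * (q ^ 2) ^ m₃)) ^ k / (q ^ 2) ^ (2 * n₂ * k) := by
    rw [pow_mul _ (2 * m₂), pow_mul _ (2 * n₂), ← div_pow, ← div_pow]
    congr 1
    rw [div_eq_div_iff (pow_ne_zero _ hp) (pow_ne_zero _ hp), neg_mul, neg_mul, ← pow_add,
      ← pow_add, ← pow_add, ← pow_add]
    congr 2
    omega
  simp only [coeffP]
  generalize ∏ i ∈ Finset.range k, (q ^ 2) ^ (3 * i + 2) = E
  set A := fallingPoch (q ^ 2) ((q ^ 2) ^ m₂) k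
  set B := fallingPoch (q ^ 2) ((q ^ 2) ^ n₂) k
  calc
    _ = E * A * B / qPoch q k
        * ((-((q ^ 2) ^ n₁ * (q ^ 2) ^ n₃)) ^ k / (q ^ 2) ^ (2 * m₂ * k))
        * (fallingPoch (q ^ 2) ((q ^ 2) ^ n₁) (m₂ - k) * qPoch q m₁)
        * (fallingPoch (q ^ 2) ((q ^ 2) ^ n₃) (m₂ - k) * qPoch q m₃) := by ring
    _ = _ := by rw [hx, hz, hpow]; ring
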